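/- arXiv:1109.3390 — 8 statements merged into one kernel-verified Lean document; each statement's English description precedes it below -/
import Mathlib

section
/- If H = (V,E) is a k-forest on n vertices, then H has at most binomial(n-1, k-1) edges. -/
/-- A `k`-graph `(V, E)` is a *`k`-forest* if for every edge `e ∈ E` there is a
surjective `k`-coloring of the vertices under which `e` is the only rainbow edge
(an edge `f` is rainbow under `c` if `|c(f)| = k`). -/
def IsKForest {V : Type*} [DecidableEq V] (k : ℕ) (E : Finset (Finset V)) : Prop :=
  ∀ e ∈ E, ∃ c : V → Fin k, Function.Surjective c ∧
    ∀ f ∈ E, ((f.image c).card = k ↔ f = e)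

open Classical in
/-- Rainbow indicator modulo two. -/
noncomputable def rbw {V : Type*} {k : ℕ} (c : V → Fin k) (f : Finset V) : ZMod 2 :=
  if Set.InjOn c (f : Set V) then 1 else 0

lemma rbw_surj {V : Type*} [DecidableEq V] {k : ℕ} (c : V → Fin k) (f : Finset V)
    (hf : f.card = k) (h : Set.InjOn c (f : Set V)) (i : Fin k) : ∃ y ∈ f, c y = i := by
  have h1 : f.image c = Finset.univ := by
    apply Finset.eq_univ_of_card
    rw [Finset.card_image_iff.mpr h, hf, Fintype.card_fin]
  have := Finset.mem_univ i
  rw [← h1, Finset.mem_image] at this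
  exact this

lemma rbw_rel {V : Type*} [DecidableEq V] {k : ℕ} (c : V → Fin k) (f : Finset V) (v : V)
    (hv : v ∉ f) (hf : f.card = k) :
    rbw c f = ∑ x ∈ f, rbw c (insert v (f.erase x)) := by
  classical
  by_cases h : Set.InjOn c (f : Set V)
  · obtain ⟨y, hy, hyv⟩ := rbw_surj c f hf h (c v)
    rw [Finset.sum_eq_single_of_mem y hy]
    · have : Set.InjOn c ((insert v (f.erase y) : Finset V) : Set V) := by
        intro a ha b hb hab
        have hi : ∀ a ∈ f, ∀ b ∈ f, c a = c b → a = b := fun a ha b hb => h ha hb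
        simp only [Finset.coe_insert, Finset.coe_erase, Set.mem_insert_iff, Set.mem_sdiff,
          Finset.mem_coe, Set.mem_singleton_iff] at ha hb
        grind
      simp only [rbw, h, this, if_true]
    · intro x hx hxy
      have : ¬ Set.InjOn c ((insert v (f.erase x) : Finset V) : Set V) := by
        intro hh
        have : y = v := hh (by simp [hy, hxy.symm]) (by simp) hyv
        exact hv (this ▸ hy)
      simp only [rbw, this, if_false]
  · by_cases h0 : ∃ x ∈ f, Set.InjOn c ((insert v (f.erase x) : Finset V) : Set V)
    · obtain ⟨x, hx, hi⟩ := h0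
      have hc : (insert v (f.erase x)).card = k := by
        rw [Finset.card_insert_of_notMem (by simp [hv]), Finset.card_erase_add_one hx, hf]
      obtain ⟨z, hz, hzx⟩ := rbw_surj c _ hc hi (c x)
      have hI : ∀ a ∈ insert v (f.erase x), ∀ b ∈ insert v (f.erase x), c a = c b → a = b :=
        fun a ha b hb => hi ha hb
      have hzv : z ≠ v := by
        rintro rfl
        apply h
        intro a ha b hb hab
        have ha' : a ∈ f := ha
        have hb' : b ∈ f := hb
        grind
      have hzf : z ∈ f := by grind
      have hzx' : z ≠ x := by grind
      have hiz : Set.InjOn c ((insert v (f.erase z) : Finset V) : Set V) := by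
        intro a ha b hb hab
        rw [Finset.mem_coe] at ha hb
        grind
      have hsub : ({x, z} : Finset V) ⊆ f := by
        intro a ha
        simp at ha
        rcases ha with rfl | rfl <;> assumption
      rw [← Finset.sum_subset hsub, Finset.sum_pair hzx'.symm]
      · simp only [rbw, h, hi, hiz, if_true, if_false]
        decide
      · intro w hw hw2
        have : ¬ Set.InjOn c ((insert v (f.erase w) : Finset V) : Set V) := by
          intro hh
          simp at hw2
          exact hzx' (hh (by simp [hzf, Ne.symm hw2.2]) (by simp [hx, Ne.symm hw2.1]) hzx)
        simp only [rbw, this, if_false]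
    · push Not at h0
      rw [Finset.sum_eq_zero]
      · simp [rbw, h]
      · intro x hx
        simp only [rbw, h0 x hx, if_false]

/-- A `k`-forest on `n` vertices has at most `(n-1).choose (k-1)` edges. -/
theorem kForest_card_le {V : Type*} [Fintype V] [DecidableEq V] (k : ℕ)
    (E : Finset (Finset V)) (huniform : ∀ e ∈ E, e.card = k)
    (hforest : IsKForest k E) :
    E.card ≤ (Fintype.card V - 1).choose (k - 1) := by
  classical
  rcases Nat.eq_zero_or_pos k with rfl | hk
  · have : E ⊆ {∅} := by
      intro e he
      simpa using huniform e he
    simpa using Finset.card_le_card this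
  rcases isEmpty_or_nonempty V with hV | ⟨⟨v⟩⟩
  · have : E = ∅ := by
      rw [Finset.eq_empty_iff_forall_notMem]
      intro e he
      have := huniform e he
      rw [Finset.eq_empty_of_isEmpty e] at this
      simp at this
      omega
    simp [this]
  haveI : Nonempty (Fin k) := ⟨⟨0, hk⟩⟩
  choose! c hc using hforest
  have hr : ∀ e ∈ E, ∀ f ∈ E, rbw (c e) f = if f = e then 1 else 0 := by
    intro e he f hf
    have h1 := (hc e he).2 f hf
    have h2 : Set.InjOn (c e) (f : Set V) ↔ f = e := by
      rw [← h1, ← Finset.card_image_iff, huniform f hf]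
    simp only [rbw, h2]
  let S := Finset.powersetCard (k - 1) (Finset.univ.erase v)
  let g : E → (S → ZMod 2) := fun e s => rbw (c e.1) (insert v s.1)
  have hS : S.card = (Fintype.card V - 1).choose (k - 1) := by
    simp [S, Finset.card_powersetCard, Finset.card_erase_of_mem]
  have hli : LinearIndependent (ZMod 2) g := by
    rw [Fintype.linearIndependent_iff]
    intro a ha
    have star : ∀ f : Finset V, f.card = k → v ∈ f → ∑ e : E, a e * rbw (c e.1) f = 0 := by
      intro f hf hvf
      have hs : f.erase v ∈ S := by
        simp only [S, Finset.mem_powersetCard]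
        exact ⟨Finset.erase_subset_erase _ (Finset.subset_univ _),
          by rw [Finset.card_erase_of_mem hvf, hf]⟩
      have := congrFun ha ⟨_, hs⟩
      simpa [g, Finset.insert_erase hvf] using this
    have all : ∀ f : Finset V, f.card = k → ∑ e : E, a e * rbw (c e.1) f = 0 := by
      intro f hf
      by_cases hvf : v ∈ f
      · exact star f hf hvf
      · simp_rw [fun e : E => rbw_rel (c e.1) f v hvf hf, Finset.mul_sum]
        rw [Finset.sum_comm]
        apply Finset.sum_eq_zero
        intro x hx
        apply star _ _ (by simp)
        rw [Finset.card_insert_of_notMem (by simp [hvf]), Finset.card_erase_add_one hx, hf]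
    intro e
    have := all e.1 (huniform _ e.2)
    rw [Finset.sum_eq_single e] at this
    · rw [hr _ e.2 _ e.2] at this
      simpa using this
    · intro b _ hb
      rw [hr _ b.2 _ e.2, if_neg (fun h => hb (Subtype.ext h.symm)), mul_zero]
    · simp
  have := hli.fintype_card_le_finrank
  rw [Module.finrank_fintype_fun_eq_card] at this
  simpa [← hS] using this
end

section
/- There exists a 3-uniform hypergraph on 6 vertices that is a saturated 3-forest but is not tight. -/
/-- A surjective `t`-coloring of the vertex set `Vs` with colors `{1, ..., t}`:
the image of `Vs` under `c` is exactly `{1, ..., t}`. -/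
def IsColoring (Vs : Finset ℕ) (t : ℕ) (c : ℕ → ℕ) : Prop :=
  Vs.image c = Finset.Icc 1 t

/-- A `k`-graph `(Vs, E)` is a *`k`-forest* if for every edge `e ∈ E` there is a
surjective `k`-coloring of `Vs` under which `e` is the only rainbow edge
(an edge `f` is rainbow under `c` if `|c(f)| = k`). -/
def IsForest (Vs : Finset ℕ) (k : ℕ) (E : Finset (Finset ℕ)) : Prop :=
  ∀ e ∈ E, ∃ c : ℕ → ℕ, IsColoring Vs k c ∧
    ∀ f ∈ E, ((f.image c).card = k ↔ f = e)

/-- The vertex set `V = {1, 2, 3, 4, 5, 6}`. -/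
def V6 : Finset ℕ := {1, 2, 3, 4, 5, 6}

/-- The edge set
`E = {{1,2,3}, {1,2,4}, {1,2,5}, {1,3,4}, {2,3,6}, {2,5,6}, {3,4,6}, {3,5,6}}`. -/
def E8 : Finset (Finset ℕ) :=
  {{1, 2, 3}, {1, 2, 4}, {1, 2, 5}, {1, 3, 4}, {2, 3, 6}, {2, 5, 6}, {3, 4, 6}, {3, 5, 6}}

/-- The heterochromatic number of the `k`-graph `(Vs, E)`: the minimum number
`t ≥ 1` of colors such that every surjective `t`-coloring of `Vs` has a rainbow
edge. -/
noncomputable def hetNumber (Vs : Finset ℕ) (k : ℕ) (E : Finset (Finset ℕ)) : ℕ :=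
  sInf {t : ℕ | 0 < t ∧ ∀ c : ℕ → ℕ, IsColoring Vs t c →
    ∃ e ∈ E, (e.image c).card = k}

/-- The coloring of `{1, ..., 6}` with the given list of colors. -/
def colL (l : List ℕ) : ℕ → ℕ := fun n => l.getD (n - 1) 0

/-- Three values are pairwise distinct. -/
def Rb (a b c : ℕ) : Prop := a ≠ b ∧ a ≠ c ∧ b ≠ c

instance (a b c : ℕ) : Decidable (Rb a b c) := by unfold Rb; infer_instance

theorem rb_iff (c : ℕ → ℕ) (x y z : ℕ) :
    ((({x, y, z} : Finset ℕ).image c).card = 3) ↔ Rb (c x) (c y) (c z) := by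
  simp only [Finset.image_insert, Finset.image_singleton, Finset.card_eq_three, Rb]
  constructor
  · intro h
    have h3 := Finset.card_eq_three.mpr h
    refine ⟨fun h => ?_, fun h => ?_, fun h => ?_⟩
    · rw [h] at h3
      simp only [Finset.mem_insert, Finset.mem_singleton, true_or, Finset.insert_eq_of_mem] at h3
      have := Finset.card_le_two (a := c y) (b := c z)
      omega
    · rw [h] at h3
      simp only [Finset.mem_insert, Finset.mem_singleton, or_true, Finset.insert_eq_of_mem] at h3
      have := Finset.card_le_two (a := c y) (b := c z)
      omega
    · rw [h] at h3
      simp only [Finset.mem_singleton, Finset.insert_eq_of_mem] at h3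
      have := Finset.card_le_two (a := c x) (b := c z)
      omega
  · rintro ⟨h1, h2, h3⟩
    exact ⟨_, _, _, h1, h2, h3, rfl⟩

set_option synthInstance.maxHeartbeats 400000 in
set_option synthInstance.maxSize 2000 in
theorem key123 : ∀ a ∈ [1, 2, 3], ∀ b ∈ [1, 2, 3], ∀ c ∈ [1, 2, 3], Rb a b c →
    ∀ d ∈ [1, 2, 3], ∀ e ∈ [1, 2, 3], ∀ f ∈ [1, 2, 3],
    ¬ Rb a b d → ¬ Rb a b e → ¬ Rb a c d → ¬ Rb b c f → ¬ Rb b e f → ¬ Rb c d f → ¬ Rb c e f →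
    Rb a b f ∧ Rb a c e ∧ Rb a e f ∧ Rb b c d ∧ Rb b d f ∧ Rb c d e ∧ Rb d e f := by
  decide +kernel

set_option synthInstance.maxHeartbeats 400000 in
set_option synthInstance.maxSize 2000 in
theorem key236 : ∀ a ∈ [1, 2, 3], ∀ b ∈ [1, 2, 3], ∀ c ∈ [1, 2, 3],
    ∀ d ∈ [1, 2, 3], ∀ e ∈ [1, 2, 3], ∀ f ∈ [1, 2, 3], Rb b c f →
    ¬ Rb a b c → ¬ Rb a b d → ¬ Rb a b e → ¬ Rb a c d → ¬ Rb b e f → ¬ Rb c d f → ¬ Rb c e f →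
    Rb a c f ∧ Rb a d e ∧ Rb a d f ∧ Rb b c e ∧ Rb b d e := by
  decide +kernel

theorem nonedges : ∀ e ∈ Finset.powersetCard 3 V6, e ∉ E8 →
    (e ∈ ({{1, 2, 6}, {1, 3, 5}, {1, 5, 6}, {2, 3, 4}, {2, 4, 6}, {3, 4, 5}, {4, 5, 6}} :
      Finset (Finset ℕ)) ∨
    e ∈ ({{1, 3, 6}, {1, 4, 5}, {1, 4, 6}, {2, 3, 5}, {2, 4, 5}} : Finset (Finset ℕ))) := by
  decide +kernel

theorem col_mem {c : ℕ → ℕ} (hc : IsColoring V6 3 c) : ∀ v ∈ V6, c v ∈ [1, 2, 3] := by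
  intro v hv
  have h : c v ∈ Finset.Icc 1 3 := by
    rw [← hc]
    exact Finset.mem_image_of_mem c hv
  rw [Finset.mem_Icc] at h
  have : c v = 1 ∨ c v = 2 ∨ c v = 3 := by omega
  simpa using this

theorem forest8 : IsForest V6 3 E8 := by
  have h : ∀ e ∈ E8, ∃ l ∈ [[1, 2, 3, 1, 2, 3], [1, 2, 1, 3, 1, 1], [1, 2, 2, 1, 3, 2],
      [1, 1, 2, 3, 1, 2], [1, 1, 2, 2, 3, 3], [1, 1, 2, 1, 3, 2], [1, 1, 1, 2, 1, 3],
      [1, 1, 2, 1, 3, 1]], V6.image (colL l) = Finset.Icc 1 3 ∧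
      ∀ f ∈ E8, ((f.image (colL l)).card = 3 ↔ f = e) := by
    decide +kernel
  intro e he
  obtain ⟨l, -, h1, h2⟩ := h e he
  exact ⟨colL l, h1, h2⟩

theorem saturated8 (e' : Finset ℕ) (hs : e' ⊆ V6) (hc : e'.card = 3) (hn : e' ∉ E8) :
    ¬ IsForest V6 3 (insert e' E8) := by
  intro hF
  have key : ∀ e ∈ E8, ∃ c : ℕ → ℕ, IsColoring V6 3 c ∧ (e'.image c).card ≠ 3 ∧
      ∀ f ∈ E8, ((f.image c).card = 3 ↔ f = e) := by
    intro e he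
    obtain ⟨c, h1, h2⟩ := hF e (Finset.mem_insert_of_mem he)
    refine ⟨c, h1, fun h => hn ?_, fun f hf => h2 f (Finset.mem_insert_of_mem hf)⟩
    rwa [(h2 e' (Finset.mem_insert_self _ _)).1 h]
  rcases nonedges e' (Finset.mem_powersetCard.2 ⟨hs, hc⟩) hn with h | h
  · obtain ⟨c, h1, h2, h3⟩ := key {1, 2, 3} (by decide)
    have m := col_mem h1
    have r : ∀ x y z, ({x, y, z} : Finset ℕ) ∈ E8 → ({x, y, z} : Finset ℕ) ≠ {1, 2, 3} →
        ¬ Rb (c x) (c y) (c z) := fun x y z hm hne hr =>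
      hne ((h3 _ hm).1 ((rb_iff c x y z).2 hr))
    have K := key123 _ (m 1 (by decide)) _ (m 2 (by decide)) _ (m 3 (by decide))
      ((rb_iff c 1 2 3).1 ((h3 _ (by decide)).2 rfl))
      _ (m 4 (by decide)) _ (m 5 (by decide)) _ (m 6 (by decide))
      (r 1 2 4 (by decide) (by decide)) (r 1 2 5 (by decide) (by decide))
      (r 1 3 4 (by decide) (by decide)) (r 2 3 6 (by decide) (by decide))
      (r 2 5 6 (by decide) (by decide)) (r 3 4 6 (by decide) (by decide))
      (r 3 5 6 (by decide) (by decide))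
    simp only [Finset.mem_insert, Finset.mem_singleton] at h
    rcases h with rfl | rfl | rfl | rfl | rfl | rfl | rfl <;> rw [Ne, rb_iff] at h2 <;> tauto
  · obtain ⟨c, h1, h2, h3⟩ := key {2, 3, 6} (by decide)
    have m := col_mem h1
    have r : ∀ x y z, ({x, y, z} : Finset ℕ) ∈ E8 → ({x, y, z} : Finset ℕ) ≠ {2, 3, 6} →
        ¬ Rb (c x) (c y) (c z) := fun x y z hm hne hr =>
      hne ((h3 _ hm).1 ((rb_iff c x y z).2 hr))
    have K := key236 _ (m 1 (by decide)) _ (m 2 (by decide)) _ (m 3 (by decide))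
      _ (m 4 (by decide)) _ (m 5 (by decide)) _ (m 6 (by decide))
      ((rb_iff c 2 3 6).1 ((h3 _ (by decide)).2 rfl))
      (r 1 2 3 (by decide) (by decide))
      (r 1 2 4 (by decide) (by decide)) (r 1 2 5 (by decide) (by decide))
      (r 1 3 4 (by decide) (by decide))
      (r 2 5 6 (by decide) (by decide)) (r 3 4 6 (by decide) (by decide))
      (r 3 5 6 (by decide) (by decide))
    simp only [Finset.mem_insert, Finset.mem_singleton] at h
    rcases h with rfl | rfl | rfl | rfl | rfl <;> rw [Ne, rb_iff] at h2 <;> tauto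

theorem not_tight8 : hetNumber V6 3 E8 ≠ 3 := by
  intro h
  unfold hetNumber at h
  have hm := Nat.sInf_mem (Nat.nonempty_of_pos_sInf (by rw [h]; norm_num))
  rw [h] at hm
  obtain ⟨e, he, h3⟩ := hm.2 (colL [1, 1, 1, 2, 3, 1]) (by unfold IsColoring; decide +kernel)
  have : ∀ e ∈ E8, (e.image (colL [1, 1, 1, 2, 3, 1])).card ≠ 3 := by decide +kernel
  exact this e he h3

/-- There exists a 3-uniform hypergraph on 6 vertices that is a saturated 3-forest
but is not tight (its heterochromatic number is not 3). -/
theorem exists_saturated_threeForest_not_tight :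
    ∃ (Vs : Finset ℕ) (E : Finset (Finset ℕ)),
      Vs.card = 6 ∧ (∀ e ∈ E, e ⊆ Vs ∧ e.card = 3) ∧
      IsForest Vs 3 E ∧
      (∀ e' ⊆ Vs, e'.card = 3 → e' ∉ E → ¬ IsForest Vs 3 (insert e' E)) ∧
      hetNumber Vs 3 E ≠ 3 := by
  exact ⟨V6, E8, by decide, by decide, forest8, saturated8, not_tight8⟩
end

section
/- Let H = (V,E) with V = {1,2,3,4,5,6} and E = {{1,2,3},{1,2,4},{1,2,5},{1,3,4},{2,3,6},{2,5,6},{3,4,6},{3,5,6}}. If c : V → {1,2,3} is a coloring under which {1,2,3} is the only rainbow edge of H, then c is, up to a permutation of the three colors, equal to the coloring c(1)=3, c(2)=2, c(3)=1, c(4)=3, c(5)=2, c(6)=1. -/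
/-- If `c : V6 → {1,2,3}` is a coloring under which `{1,2,3}` is the only rainbow
edge of `(V6, E8)`, then up to a permutation `σ` of the three colors, `c` is the
coloring `c 1 = 3, c 2 = 2, c 3 = 1, c 4 = 3, c 5 = 2, c 6 = 1`. -/
theorem unique_coloring_123 (c : ℕ → ℕ)
    (hrange : ∀ v ∈ V6, c v ∈ Finset.Icc 1 3)
    (honly : ∀ f ∈ E8, ((f.image c).card = 3 ↔ f = ({1, 2, 3} : Finset ℕ))) :
    ∃ σ : ℕ → ℕ, Set.BijOn σ {1, 2, 3} {1, 2, 3} ∧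
      c 1 = σ 3 ∧ c 2 = σ 2 ∧ c 3 = σ 1 ∧ c 4 = σ 3 ∧ c 5 = σ 2 ∧ c 6 = σ 1 := by
  have card3 : ∀ a b d : ℕ, (({a, b, d} : Finset ℕ).image c).card = 3 ↔
      (c a ≠ c b ∧ c a ≠ c d ∧ c b ≠ c d) := by
    intro a b d
    simp only [Finset.image_insert, Finset.image_singleton]
    constructor
    · intro h
      refine ⟨?_, ?_, ?_⟩ <;> intro he <;> rw [he] at h
      · have := Finset.card_le_two (a := c b) (b := c d)
        simp at h; omega
      · have := Finset.card_le_two (a := c b) (b := c d)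
        simp at h; omega
      · have := Finset.card_le_two (a := c a) (b := c d)
        simp at h; omega
    · exact fun h => Finset.card_eq_three.2 ⟨_, _, _, h.1, h.2.1, h.2.2, rfl⟩
  have h123 := (card3 1 2 3).1 ((honly {1, 2, 3} (by decide)).2 rfl)
  have h124 := fun h => absurd (b := False) ((honly {1, 2, 4} (by decide)).1 ((card3 1 2 4).2 h)) (by decide)
  have h125 := fun h => absurd (b := False) ((honly {1, 2, 5} (by decide)).1 ((card3 1 2 5).2 h)) (by decide)
  have h134 := fun h => absurd (b := False) ((honly {1, 3, 4} (by decide)).1 ((card3 1 3 4).2 h)) (by decide)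
  have h236 := fun h => absurd (b := False) ((honly {2, 3, 6} (by decide)).1 ((card3 2 3 6).2 h)) (by decide)
  have h256 := fun h => absurd (b := False) ((honly {2, 5, 6} (by decide)).1 ((card3 2 5 6).2 h)) (by decide)
  have h346 := fun h => absurd (b := False) ((honly {3, 4, 6} (by decide)).1 ((card3 3 4 6).2 h)) (by decide)
  have r : ∀ v ∈ V6, 1 ≤ c v ∧ c v ≤ 3 := fun v hv => Finset.mem_Icc.1 (hrange v hv)
  have r1 := r 1 (by decide)
  have r2 := r 2 (by decide)
  have r3 := r 3 (by decide)
  have r4 := r 4 (by decide)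
  have r5 := r 5 (by decide)
  have r6 := r 6 (by decide)
  clear card3 honly hrange r
  have e4 : c 4 = c 1 := by
    by_contra hne
    have a : c 4 = c 2 := by
      by_contra h
      exact h124 ⟨h123.1, fun e => hne e.symm, fun e => h e.symm⟩
    exact h134 ⟨h123.2.1, fun e => hne e.symm,
      fun e => h123.2.2 (e.trans a).symm⟩
  have e6 : c 6 = c 3 := by
    by_contra hne
    have a : c 6 = c 2 := by
      by_contra h
      exact h236 ⟨h123.2.2, fun e => h e.symm, fun e => hne e.symm⟩
    exact h346 ⟨fun e => h123.2.1 (e.trans e4).symm, fun e => hne e.symm,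
      fun e => h123.1 (e4.symm.trans (e.trans a))⟩
  have e5 : c 5 = c 2 := by
    by_contra hne
    have a : c 5 = c 1 := by
      by_contra h
      exact h125 ⟨h123.1, fun e => h e.symm, fun e => hne e.symm⟩
    exact h256 ⟨fun e => hne e.symm, fun e => h123.2.2 (e.trans e6),
      fun e => h123.2.1 (a.symm.trans (e.trans e6))⟩
  clear h124 h125 h134 h236 h256 h346 r4 r5 r6
  obtain ⟨n12, n13, n23⟩ := h123
  refine ⟨fun n => c (4 - n), ⟨?_, ?_, ?_⟩, rfl, rfl, rfl,
    by simpa using e4, by simpa using e5, by simpa using e6⟩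
  · rintro x (rfl | rfl | rfl) <;>
      simp only [Set.mem_insert_iff, Set.mem_singleton_iff, Nat.reduceSub] <;> omega
  · rintro x (rfl | rfl | rfl) y (rfl | rfl | rfl) h <;>
      simp only [Nat.reduceSub] at h <;>
      first | rfl | exact absurd h n12 | exact absurd h n13 | exact absurd h n23
            | exact absurd h.symm n12 | exact absurd h.symm n13 | exact absurd h.symm n23
  · intro y hy
    simp only [Set.mem_insert_iff, Set.mem_singleton_iff] at hy
    have : y = c 1 ∨ y = c 2 ∨ y = c 3 := by omega
    rcases this with h | h | h
    · exact ⟨3, by simp, h.symm⟩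
    · exact ⟨2, by simp, h.symm⟩
    · exact ⟨1, by simp, h.symm⟩
end

section
/- Let H = (V,E) with V = {1,2,3,4,5,6} and E = {{1,2,3},{1,2,4},{1,2,5},{1,3,4},{2,3,6},{2,5,6},{3,4,6},{3,5,6}}. If c : V → {1,2,3} is a coloring under which {1,3,4} is the only rainbow edge of H, then c is, up to a permutation of the three colors, one of exactly two colorings: c(1)=3, c(2)=3, c(3)=1, c(4)=2, c(6)=1, with c(5) ∈ {1,3}. -/
/-- A triple is rainbow iff its three colors are pairwise distinct. -/
theorem rainbow_iff (c : ℕ → ℕ) (x y z : ℕ) :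
    ((({x, y, z} : Finset ℕ).image c).card = 3) ↔ (c x ≠ c y ∧ c x ≠ c z ∧ c y ≠ c z) := by
  rw [Finset.image_insert, Finset.image_insert, Finset.image_singleton]
  constructor
  · intro h
    refine ⟨?_, ?_, ?_⟩ <;> intro e <;> rw [e] at h
    · have := Finset.card_le_two (a := c y) (b := c z)
      simp at h
      omega
    · have := Finset.card_le_two (a := c y) (b := c z)
      rw [Finset.insert_comm] at h
      simp at h
      omega
    · have := Finset.card_le_two (a := c x) (b := c z)
      simp at h
      omega
  · rintro ⟨h1, h2, h3⟩
    exact Finset.card_eq_three.2 ⟨_, _, _, h1, h2, h3, rfl⟩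

/-- If `c : V6 → {1,2,3}` is a coloring under which `{1,3,4}` is the only rainbow
edge of `(V6, E8)`, then up to a permutation `σ` of the three colors, `c` is one of
exactly two colorings: `c 1 = 3, c 2 = 3, c 3 = 1, c 4 = 2, c 6 = 1`, with
`c 5 ∈ {1, 3}`. -/
theorem coloring_134 (c : ℕ → ℕ)
    (hrange : ∀ v ∈ V6, c v ∈ Finset.Icc 1 3)
    (honly : ∀ f ∈ E8, ((f.image c).card = 3 ↔ f = ({1, 3, 4} : Finset ℕ))) :
    ∃ σ : ℕ → ℕ, Set.BijOn σ {1, 2, 3} {1, 2, 3} ∧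
      c 1 = σ 3 ∧ c 2 = σ 3 ∧ c 3 = σ 1 ∧ c 4 = σ 2 ∧ (c 5 = σ 1 ∨ c 5 = σ 3) ∧
      c 6 = σ 1 := by
  have key : ∀ x y z : ℕ, ({x, y, z} : Finset ℕ) ∈ E8 →
      ((c x ≠ c y ∧ c x ≠ c z ∧ c y ≠ c z) ↔ ({x, y, z} : Finset ℕ) = {1, 3, 4}) :=
    fun x y z h => (rainbow_iff c x y z).symm.trans (honly _ h)
  have a134 := (key 1 3 4 (by decide)).2 rfl
  have a123 := mt (key 1 2 3 (by decide)).1 (by decide)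
  have a124 := mt (key 1 2 4 (by decide)).1 (by decide)
  have a236 := mt (key 2 3 6 (by decide)).1 (by decide)
  have a256 := mt (key 2 5 6 (by decide)).1 (by decide)
  have a346 := mt (key 3 4 6 (by decide)).1 (by decide)
  have r1 := Finset.mem_Icc.1 (hrange 1 (by decide))
  have r3 := Finset.mem_Icc.1 (hrange 3 (by decide))
  have r4 := Finset.mem_Icc.1 (hrange 4 (by decide))
  have e2 : c 2 = c 1 := by
    by_contra h
    by_cases h' : c 2 = c 3
    · exact a124 ⟨by omega, by omega, by omega⟩
    · exact a123 ⟨by omega, by omega, by omega⟩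
  have e6 : c 6 = c 3 := by
    by_contra h
    by_cases h' : c 6 = c 4
    · exact a236 ⟨by omega, by omega, by omega⟩
    · exact a346 ⟨by omega, by omega, by omega⟩
  have e5 : c 5 = c 3 ∨ c 5 = c 1 := by
    by_contra h
    exact a256 ⟨by omega, by omega, by omega⟩
  refine ⟨fun n => if n = 1 then c 3 else if n = 2 then c 4 else c 1,
    ⟨?_, ?_, ?_⟩, by simp, by simpa using e2, by simp, by simp, by simpa using e5,
    by simpa using e6⟩
  · rintro x (rfl | rfl | rfl) <;> simp <;> omega
  · rintro x (rfl | rfl | rfl) y (rfl | rfl | rfl) <;> simp <;> omega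
  · intro y hy
    have hy' : y = c 3 ∨ y = c 4 ∨ y = c 1 := by
      have hy3 : 1 ≤ y ∧ y ≤ 3 := by
        rcases hy with rfl | rfl | rfl <;> simp
      clear a123 a124 a236 a256 a346 e2 e5 e6 key honly hrange hy
      generalize c 1 = p at *
      generalize c 3 = q at *
      generalize c 4 = r at *
      obtain ⟨h1, h2, h3⟩ := a134
      by_contra hcon
      push Not at hcon
      obtain ⟨g1, g2, g3⟩ := hcon
      have i1 : p = 1 ∨ p = 2 ∨ p = 3 := by omega
      have i2 : q = 1 ∨ q = 2 ∨ q = 3 := by omega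
      rcases i1 with rfl | rfl | rfl <;> rcases i2 with rfl | rfl | rfl <;> omega
    rcases hy' with h | h | h
    · exact ⟨1, by simp, by simp [h]⟩
    · exact ⟨2, by simp, by simp [h]⟩
    · exact ⟨3, by simp, by simp [h]⟩
end

section
/- Let H = (V,E) with V = {1,2,3,4,5,6} and E = {{1,2,3},{1,2,4},{1,2,5},{1,3,4},{2,3,6},{2,5,6},{3,4,6},{3,5,6}}. If c : V → {1,2,3} is a coloring under which {2,3,6} is the only rainbow edge of H, then c is, up to a permutation of the three colors, equal to the coloring c(1)=3, c(2)=3, c(3)=2, c(4)=2, c(5)=1, c(6)=1. -/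
theorem card_triple_aux (x y z : ℕ) :
    ({x, y, z} : Finset ℕ).card = 3 ↔ x ≠ y ∧ x ≠ z ∧ y ≠ z := by
  by_cases h1 : x = y <;> by_cases h2 : x = z <;> by_cases h3 : y = z <;>
    simp_all [Finset.card_insert_of_notMem] <;>
    exact fun h => by have := Finset.card_le_two (a := x) (b := z); omega

/-- If `c : V6 → {1,2,3}` is a coloring under which `{2,3,6}` is the only rainbow
edge of `(V6, E8)`, then up to a permutation `σ` of the three colors, `c` is the
coloring `c 1 = 3, c 2 = 3, c 3 = 2, c 4 = 2, c 5 = 1, c 6 = 1`. -/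
theorem unique_coloring_236 (c : ℕ → ℕ)
    (hrange : ∀ v ∈ V6, c v ∈ Finset.Icc 1 3)
    (honly : ∀ f ∈ E8, ((f.image c).card = 3 ↔ f = ({2, 3, 6} : Finset ℕ))) :
    ∃ σ : ℕ → ℕ, Set.BijOn σ {1, 2, 3} {1, 2, 3} ∧
      c 1 = σ 3 ∧ c 2 = σ 3 ∧ c 3 = σ 2 ∧ c 4 = σ 2 ∧ c 5 = σ 1 ∧ c 6 = σ 1 := by
  have key : ∀ x y z : ℕ, ({x, y, z} : Finset ℕ) ∈ E8 →
      ((c x ≠ c y ∧ c x ≠ c z ∧ c y ≠ c z) ↔ ({x, y, z} : Finset ℕ) = {2, 3, 6}) := by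
    intro x y z h
    rw [← honly _ h, Finset.image_insert, Finset.image_insert, Finset.image_singleton,
      card_triple_aux]
  have h236 := (key 2 3 6 (by decide)).2 rfl
  have h123 := mt (key 1 2 3 (by decide)).1 (by decide)
  have h125 := mt (key 1 2 5 (by decide)).1 (by decide)
  have h134 := mt (key 1 3 4 (by decide)).1 (by decide)
  have h256 := mt (key 2 5 6 (by decide)).1 (by decide)
  have h346 := mt (key 3 4 6 (by decide)).1 (by decide)
  have h356 := mt (key 3 5 6 (by decide)).1 (by decide)
  have r2 := Finset.mem_Icc.1 (hrange 2 (by decide))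
  have r3 := Finset.mem_Icc.1 (hrange 3 (by decide))
  have r6 := Finset.mem_Icc.1 (hrange 6 (by decide))
  have e5 : c 5 = c 6 := by grind
  have e1 : c 1 = c 2 := by grind
  have e4 : c 4 = c 3 := by grind
  clear key honly hrange h123 h125 h134 h256 h346 h356
  refine ⟨fun n => if n = 1 then c 6 else if n = 2 then c 3 else c 2, ⟨?_, ?_, ?_⟩, ?_⟩
  · intro n hn
    simp only [Set.mem_insert_iff, Set.mem_singleton_iff] at hn ⊢
    split_ifs <;> omega
  · intro n hn m hm h
    simp only [Set.mem_insert_iff, Set.mem_singleton_iff] at hn hm h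
    split_ifs at h <;> omega
  · intro n hn
    simp only [Set.mem_insert_iff, Set.mem_singleton_iff] at hn
    have : n = c 6 ∨ n = c 3 ∨ n = c 2 := by omega
    rcases this with h | h | h
    · exact ⟨1, by simp, by simp [h]⟩
    · exact ⟨2, by simp, by simp [h]⟩
    · exact ⟨3, by simp, by simp [h]⟩
  · simp [e1, e4, e5]
end

section
/- Let H = (V,E) with V = {1,2,3,4,5,6} and E = {{1,2,3},{1,2,4},{1,2,5},{1,3,4},{2,3,6},{2,5,6},{3,4,6},{3,5,6}}. For every coloring c : V → {1,2,3} under which {1,2,3} is the only rainbow edge of H, each of the triples {1,2,6}, {1,3,5}, {1,5,6}, {2,4,6}, {3,4,5}, {4,5,6} is rainbow under c. Consequently, for each such triple e', the 3-graph (V, E ∪ {e'}) is not a 3-forest. -/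
theorem forced (c : ℕ → ℕ)
    (h : ∀ f ∈ E8, ((f.image c).card = 3 ↔ f = ({1, 2, 3} : Finset ℕ))) :
    ∀ e' ∈ ({{1, 2, 6}, {1, 3, 5}, {1, 5, 6}, {2, 4, 6}, {3, 4, 5}, {4, 5, 6}} :
      Finset (Finset ℕ)), (e'.image c).card = 3 := by
  have a1 := (rainbow_iff c 1 2 3).mp ((h {1, 2, 3} (by decide)).mpr rfl)
  have key : ∀ x y z : ℕ, ({x, y, z} : Finset ℕ) ∈ E8 → ({x, y, z} : Finset ℕ) ≠ {1, 2, 3} →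
      ¬ (c x ≠ c y ∧ c x ≠ c z ∧ c y ≠ c z) := fun x y z hm hn hr =>
    hn ((h _ hm).mp ((rainbow_iff c x y z).mpr hr))
  have a2 := key 1 2 4 (by decide) (by decide)
  have a3 := key 1 2 5 (by decide) (by decide)
  have a4 := key 1 3 4 (by decide) (by decide)
  have a5 := key 2 3 6 (by decide) (by decide)
  have a6 := key 2 5 6 (by decide) (by decide)
  have a7 := key 3 4 6 (by decide) (by decide)
  have h4 : c 4 = c 1 := by clear a3 a5 a6 a7 key h; grind
  have h6 : c 6 = c 3 := by clear a2 a3 a4 a6 key h; grind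
  have h5 : c 5 = c 2 := by clear a2 a4 a5 a7 key h; grind
  intro e' he'
  simp only [Finset.mem_insert, Finset.mem_singleton] at he'
  rcases he' with rfl | rfl | rfl | rfl | rfl | rfl <;> rw [rainbow_iff] <;>
    clear a2 a3 a4 a5 a6 a7 key h <;> grind

/-- For every coloring `c : V6 → {1,2,3}` under which `{1,2,3}` is the only rainbow
edge of `(V6, E8)`, each of the triples `{1,2,6}, {1,3,5}, {1,5,6}, {2,4,6}, {3,4,5},
{4,5,6}` is rainbow under `c`. Consequently, adding any of these triples to `E8`
yields a 3-graph that is not a 3-forest. -/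
theorem nonedges_123 :
    (∀ c : ℕ → ℕ, (∀ v ∈ V6, c v ∈ Finset.Icc 1 3) →
      (∀ f ∈ E8, ((f.image c).card = 3 ↔ f = ({1, 2, 3} : Finset ℕ))) →
      ∀ e' ∈ ({{1, 2, 6}, {1, 3, 5}, {1, 5, 6}, {2, 4, 6}, {3, 4, 5}, {4, 5, 6}} :
        Finset (Finset ℕ)), (e'.image c).card = 3) ∧
    ∀ e' ∈ ({{1, 2, 6}, {1, 3, 5}, {1, 5, 6}, {2, 4, 6}, {3, 4, 5}, {4, 5, 6}} :
      Finset (Finset ℕ)), ¬ IsForest V6 3 (insert e' E8) := by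
  refine ⟨fun c _ h => forced c h, ?_⟩
  intro e' he' hF
  obtain ⟨c, -, hc⟩ := hF {1, 2, 3} (Finset.mem_insert_of_mem (by decide))
  have h1 := forced c (fun f hf => hc f (Finset.mem_insert_of_mem hf)) e' he'
  have h2 := (hc e' (Finset.mem_insert_self _ _)).mp h1
  subst h2
  exact absurd he' (by decide)
end

section
/- Let H = (V,E) with V = {1,2,3,4,5,6} and E = {{1,2,3},{1,2,4},{1,2,5},{1,3,4},{2,3,6},{2,5,6},{3,4,6},{3,5,6}}. For every coloring c : V → {1,2,3} under which {1,3,4} is the only rainbow edge of H, each of the triples {1,4,6}, {2,3,4}, {2,4,6} is rainbow under c. Consequently, for each such triple e', the 3-graph (V, E ∪ {e'}) is not a 3-forest. -/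
theorem rainbow_aux (c : ℕ → ℕ) (hv : ∀ v ∈ V6, c v ∈ Finset.Icc 1 3)
    (h : ∀ f ∈ E8, ((f.image c).card = 3 ↔ f = ({1, 3, 4} : Finset ℕ))) :
    ∀ e' ∈ ({{1, 4, 6}, {2, 3, 4}, {2, 4, 6}} : Finset (Finset ℕ)),
        (e'.image c).card = 3 := by
  have b1 := Finset.mem_Icc.mp (hv 1 (by decide))
  have b2 := Finset.mem_Icc.mp (hv 2 (by decide))
  have b3 := Finset.mem_Icc.mp (hv 3 (by decide))
  have b4 := Finset.mem_Icc.mp (hv 4 (by decide))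
  have b6 := Finset.mem_Icc.mp (hv 6 (by decide))
  have h134 := (rainbow_iff c 1 3 4).mp ((h {1, 3, 4} (by decide)).mpr rfl)
  have n123 := mt (h {1, 2, 3} (by decide)).mp (by decide)
  have n124 := mt (h {1, 2, 4} (by decide)).mp (by decide)
  have n236 := mt (h {2, 3, 6} (by decide)).mp (by decide)
  have n346 := mt (h {3, 4, 6} (by decide)).mp (by decide)
  rw [rainbow_iff] at n123 n124 n236 n346
  have e2 : c 2 = c 1 := by omega
  have e6 : c 6 = c 3 := by omega
  intro e' he
  simp only [Finset.mem_insert, Finset.mem_singleton] at he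
  rcases he with rfl | rfl | rfl <;> rw [rainbow_iff] <;> omega

/-- For every coloring `c : V6 → {1,2,3}` under which `{1,3,4}` is the only rainbow
edge of `(V6, E8)`, each of the triples `{1,4,6}, {2,3,4}, {2,4,6}` is rainbow under
`c`. Consequently, adding any of these triples to `E8` yields a 3-graph that is not
a 3-forest. -/
theorem nonedges_134 :
    (∀ c : ℕ → ℕ, (∀ v ∈ V6, c v ∈ Finset.Icc 1 3) →
      (∀ f ∈ E8, ((f.image c).card = 3 ↔ f = ({1, 3, 4} : Finset ℕ))) →
      ∀ e' ∈ ({{1, 4, 6}, {2, 3, 4}, {2, 4, 6}} : Finset (Finset ℕ)),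
        (e'.image c).card = 3) ∧
    ∀ e' ∈ ({{1, 4, 6}, {2, 3, 4}, {2, 4, 6}} : Finset (Finset ℕ)),
      ¬ IsForest V6 3 (insert e' E8) := by
  refine ⟨rainbow_aux, ?_⟩
  intro e' he hF
  obtain ⟨c, hc, hr⟩ := hF {1, 3, 4} (Finset.mem_insert_of_mem (by decide))
  have hv : ∀ v ∈ V6, c v ∈ Finset.Icc 1 3 := by
    intro v hv
    rw [← (show V6.image c = Finset.Icc 1 3 from hc)]
    exact Finset.mem_image_of_mem c hv
  have h3 := rainbow_aux c hv (fun f hf => hr f (Finset.mem_insert_of_mem hf)) e' he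
  have h4 := (hr e' (Finset.mem_insert_self _ _)).mp h3
  rw [h4] at he
  exact absurd he (by decide)
end

section
/- Let H = (V,E) with V = {1,2,3,4,5,6} and E = {{1,2,3},{1,2,4},{1,2,5},{1,3,4},{2,3,6},{2,5,6},{3,4,6},{3,5,6}}. For every coloring c : V → {1,2,3} under which {2,3,6} is the only rainbow edge of H, each of the triples {1,3,5}, {1,3,6}, {1,4,5}, {1,4,6}, {2,3,5}, {2,4,5}, {2,4,6} is rainbow under c. Consequently, for each such triple e', the 3-graph (V, E ∪ {e'}) is not a 3-forest. -/
/-- The first claim; the bound on the colors is not needed. -/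
theorem forced_rainbow (c : ℕ → ℕ)
    (h : ∀ f ∈ E8, ((f.image c).card = 3 ↔ f = ({2, 3, 6} : Finset ℕ))) :
    ∀ e' ∈ ({{1, 3, 5}, {1, 3, 6}, {1, 4, 5}, {1, 4, 6}, {2, 3, 5}, {2, 4, 5},
      {2, 4, 6}} : Finset (Finset ℕ)), (e'.image c).card = 3 := by
  have a1 := (rainbow_iff c 2 3 6).1 ((h {2, 3, 6} (by decide)).2 rfl)
  have no : ∀ x y z : ℕ, ({x, y, z} : Finset ℕ) ∈ E8 → ({x, y, z} : Finset ℕ) ≠ {2, 3, 6} →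
      ¬ (c x ≠ c y ∧ c x ≠ c z ∧ c y ≠ c z) :=
    fun x y z hm hn hr => hn ((h _ hm).1 ((rainbow_iff c x y z).2 hr))
  have b1 := no 1 2 3 (by decide) (by decide)
  have b2 := no 1 2 5 (by decide) (by decide)
  have b3 := no 1 3 4 (by decide) (by decide)
  have b4 := no 2 5 6 (by decide) (by decide)
  have b5 := no 3 4 6 (by decide) (by decide)
  have b6 := no 3 5 6 (by decide) (by decide)
  obtain ⟨n1, n2, n3⟩ := a1
  have e5 : c 5 = c 6 := by omega
  have e1 : c 1 = c 2 := by omega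
  have e4 : c 4 = c 3 := by omega
  intro e' he'
  simp only [Finset.mem_insert, Finset.mem_singleton] at he'
  rcases he' with rfl | rfl | rfl | rfl | rfl | rfl | rfl <;>
    rw [rainbow_iff] <;> omega

/-- For every coloring `c : V6 → {1,2,3}` under which `{2,3,6}` is the only rainbow
edge of `(V6, E8)`, each of the triples `{1,3,5}, {1,3,6}, {1,4,5}, {1,4,6}, {2,3,5},
{2,4,5}, {2,4,6}` is rainbow under `c`. Consequently, adding any of these triples to
`E8` yields a 3-graph that is not a 3-forest. -/
theorem nonedges_236 :
    (∀ c : ℕ → ℕ, (∀ v ∈ V6, c v ∈ Finset.Icc 1 3) →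
      (∀ f ∈ E8, ((f.image c).card = 3 ↔ f = ({2, 3, 6} : Finset ℕ))) →
      ∀ e' ∈ ({{1, 3, 5}, {1, 3, 6}, {1, 4, 5}, {1, 4, 6}, {2, 3, 5}, {2, 4, 5},
        {2, 4, 6}} : Finset (Finset ℕ)), (e'.image c).card = 3) ∧
    ∀ e' ∈ ({{1, 3, 5}, {1, 3, 6}, {1, 4, 5}, {1, 4, 6}, {2, 3, 5}, {2, 4, 5},
      {2, 4, 6}} : Finset (Finset ℕ)), ¬ IsForest V6 3 (insert e' E8) := by
  refine ⟨fun c _ h => forced_rainbow c h, fun e' he' hF => ?_⟩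
  obtain ⟨c, -, hc⟩ := hF {2, 3, 6} (Finset.mem_insert_of_mem (by decide))
  have hr := forced_rainbow c (fun f hf => hc f (Finset.mem_insert_of_mem hf)) e' he'
  have heq := (hc e' (Finset.mem_insert_self _ _)).1 hr
  subst heq
  exact absurd he' (by decide)
end
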